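/- Let G = ([n], E) be a finite simple graph and let γ be an acyclic orientation of G with source components S_1, …, S_k. Let (D_1, …, D_ℓ) be an ordered set partition of [n] such that min(D_1) < min(D_2) < … < min(D_ℓ) and such that whenever γ directs an edge {a,b} ∈ E towards b, the index of the block containing b is at most the index of the block containing a. Then for every j ≥ 0, S_1 ∪ … ∪ S_j ⊆ D_1 ∪ … ∪ D_j (where blocks with index exceeding ℓ or k are taken to be empty); in particular, ℓ ≤ k. -/

import Mathlib

open Classical

/-- The set of vertices reachable from `i` by a directed path of `γ` (including `i`). -/
noncomputable def reachSet {n : ℕ} (γ : Fin n → Fin n → Prop) (i : Fin n) : Finset (Fin n) :=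
  Finset.univ.filter fun j => Relation.ReflTransGen γ i j

/-- `scAcc γ k` is the union `S₁ ∪ ⋯ ∪ S_k` of the first `k` source components of `γ`. -/
noncomputable def scAcc {n : ℕ} (γ : Fin n → Fin n → Prop) : ℕ → Finset (Fin n)
  | 0 => ∅
  | k + 1 =>
      if h : (Finset.univ \ scAcc γ k).Nonempty then
        scAcc γ k ∪ reachSet γ ((Finset.univ \ scAcc γ k).min' h)
      else scAcc γ k

/-- `sourceComp γ k` is the `(k+1)`-st source component `S_{k+1}` of `γ`
(so the source components of the paper are `sourceComp γ 0, sourceComp γ 1, …`). -/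
noncomputable def sourceComp {n : ℕ} (γ : Fin n → Fin n → Prop) (k : ℕ) : Finset (Fin n) :=
  scAcc γ (k + 1) \ scAcc γ k

/-- The number of (nonempty) source components of `γ`. -/
noncomputable def numSourceComps {n : ℕ} (γ : Fin n → Fin n → Prop) : ℕ :=
  ((Finset.range n).filter fun k => (sourceComp γ k).Nonempty).card

theorem min'_mem_sourceComp {n : ℕ} (γ : Fin n → Fin n → Prop) (k : ℕ)
    (h : (Finset.univ \ scAcc γ k).Nonempty) :
    (Finset.univ \ scAcc γ k).min' h ∈ sourceComp γ k := by
  have hm := Finset.min'_mem _ h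
  rw [Finset.mem_sdiff] at hm
  rw [sourceComp, Finset.mem_sdiff, scAcc, dif_pos h]
  refine ⟨Finset.mem_union_right _ ?_, hm.2⟩
  simp [reachSet, Relation.ReflTransGen.refl]

theorem blockIndex_le_of_reflTransGen {n : ℕ} {γ : Fin n → Fin n → Prop}
    {ℓ : ℕ} {D : ℕ → Finset (Fin n)}
    (hDdisj : ∀ i < ℓ, ∀ j < ℓ, i ≠ j → Disjoint (D i) (D j))
    (hDcover : ∀ x : Fin n, ∃ i < ℓ, x ∈ D i)
    (hcompat : ∀ a b : Fin n, γ a b → ∀ i < ℓ, ∀ j < ℓ, a ∈ D i → b ∈ D j → j ≤ i)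
    {a b : Fin n} (hab : Relation.ReflTransGen γ a b) {i j : ℕ} (hi : i < ℓ) (hj : j < ℓ)
    (ha : a ∈ D i) (hb : b ∈ D j) : j ≤ i := by
  induction hab generalizing j with
  | refl =>
    by_contra hne
    exact Finset.disjoint_left.mp (hDdisj i hi j hj (by omega)) ha hb
  | tail _ hbc ih =>
    obtain ⟨k, hk, hbk⟩ := hDcover _
    exact (hcompat _ _ hbc k hk j hj hbk hb).trans (ih hk hbk)

/-- if `(D₁, …, D_ℓ)` is an ordered set partition of `[n]` with strictly
increasing block minima that is compatible with an acyclic orientation `γ` of `G`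
(whenever `γ` directs an edge towards `b`, the block index of `b` is at most that of `a`),
then `S₁ ∪ ⋯ ∪ S_j ⊆ D₁ ∪ ⋯ ∪ D_j` for every `j`, and in particular `ℓ ≤ k`, the number
of source components of `γ`. -/
theorem sourceComp_union_subset_compatible_partition {n : ℕ}
    (G : SimpleGraph (Fin n)) (γ : Fin n → Fin n → Prop)
    (hor : ∀ a b, γ a b → G.Adj a b)
    (hone : ∀ a b, G.Adj a b → (γ a b ↔ ¬ γ b a))
    (hacyc : ∀ a, ¬ Relation.TransGen γ a a)
    (ℓ : ℕ) (D : ℕ → Finset (Fin n))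
    (hDne : ∀ i < ℓ, (D i).Nonempty)
    (hDdisj : ∀ i < ℓ, ∀ j < ℓ, i ≠ j → Disjoint (D i) (D j))
    (hDcover : ∀ x : Fin n, ∃ i < ℓ, x ∈ D i)
    (hDmin : ∀ (i j : ℕ) (hi : i < ℓ) (hj : j < ℓ), i < j →
      (D i).min' (hDne i hi) < (D j).min' (hDne j hj))
    (hcompat : ∀ a b : Fin n, γ a b → ∀ i < ℓ, ∀ j < ℓ, a ∈ D i → b ∈ D j → j ≤ i) :
    (∀ j : ℕ, scAcc γ j ⊆ (Finset.range (min j ℓ)).biUnion D) ∧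
      ℓ ≤ numSourceComps γ := by
  have not_mem_of_subset : ∀ j, scAcc γ j ⊆ (Finset.range (min j ℓ)).biUnion D →
      ∀ i < ℓ, j ≤ i → ∀ x ∈ D i, x ∉ scAcc γ j := by
    intro j hsub i hi hji x hx hxs
    obtain ⟨i', hi', hx'⟩ := Finset.mem_biUnion.mp (hsub hxs)
    rw [Finset.mem_range] at hi'
    exact Finset.disjoint_left.mp (hDdisj i hi i' (by omega) (by omega)) hx hx'
  have subset : ∀ j : ℕ, scAcc γ j ⊆ (Finset.range (min j ℓ)).biUnion D := by
    intro j
    induction j with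
    | zero => simp [scAcc]
    | succ j ih =>
      have mono : (Finset.range (min j ℓ)).biUnion D ⊆
          (Finset.range (min (j + 1) ℓ)).biUnion D :=
        Finset.biUnion_subset_biUnion_of_subset_left _
          (Finset.range_subset_range.mpr (by omega))
      rw [scAcc]
      split_ifs with h
      · refine Finset.union_subset (ih.trans mono) fun x hx => ?_
        have hreach : Relation.ReflTransGen γ ((Finset.univ \ scAcc γ j).min' h) x := by
          simpa [reachSet] using hx
        obtain ⟨p, hp, hxp⟩ := hDcover x
        obtain ⟨q, hq, hmq⟩ := hDcover ((Finset.univ \ scAcc γ j).min' h)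
        have hpq : p ≤ q :=
          blockIndex_le_of_reflTransGen hDdisj hDcover hcompat hreach hq hp hmq hxp
        have hqj : q ≤ j := by
          by_contra! hjq
          have hj : j < ℓ := hjq.trans hq
          have hle : (Finset.univ \ scAcc γ j).min' h ≤ (D j).min' (hDne j hj) :=
            Finset.min'_le _ _ (Finset.mem_sdiff.mpr ⟨Finset.mem_univ _,
              not_mem_of_subset j ih j hj le_rfl _ (Finset.min'_mem _ _)⟩)
          exact absurd ((hDmin j q hj hq hjq).trans_le (Finset.min'_le _ _ hmq)) hle.not_gt
        exact Finset.mem_biUnion.mpr ⟨p, Finset.mem_range.mpr (by omega), hxp⟩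
      · exact ih.trans mono
  refine ⟨subset, ?_⟩
  have hℓn : ℓ ≤ n := by
    have hmono : StrictMono fun i : Fin ℓ => (D i).min' (hDne i i.2) :=
      fun i j hij => hDmin i j i.2 j.2 hij
    simpa using Fintype.card_le_of_injective _ hmono.injective
  rw [numSourceComps, ← Finset.card_range ℓ]
  refine Finset.card_le_card fun k hk => ?_
  rw [Finset.mem_range] at hk
  obtain ⟨x, hx⟩ := hDne k hk
  exact Finset.mem_filter.mpr ⟨Finset.mem_range.mpr (hk.trans_le hℓn), _,
    min'_mem_sourceComp γ k ⟨x, Finset.mem_sdiff.mpr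
      ⟨Finset.mem_univ _, not_mem_of_subset k (subset k) k hk le_rfl x hx⟩⟩⟩
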